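/- Let n ≥ 1 and let H be a connected solvable subgroup of O(1,n). Then H preserves a direction in ℝ^{n+1}: there exists a nonzero vector v ∈ ℝ^{n+1} such that g·v ∈ ℝ_{>0}·v for every g ∈ H. -/

import Mathlib

noncomputable section

open Matrix

/-- The Lorentzian bilinear form of signature `(1,n)` on `ℝ^{n+1}`:
`B(x,y) = -x₀y₀ + x₁y₁ + ⋯ + xₙyₙ`. -/
def lorentzB (n : ℕ) (x y : Fin (n + 1) → ℝ) : ℝ :=
  -(x 0 * y 0) + ∑ i : Fin n, x i.succ * y i.succ

/-- The Lorentz group `O(1,n)`: the subgroup of `GL_{n+1}(ℝ)` preserving the Lorentzian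
form `lorentzB n`. -/
def LorentzO (n : ℕ) : Subgroup (GL (Fin (n + 1)) ℝ) where
  carrier := {A | ∀ x y : Fin (n + 1) → ℝ,
    lorentzB n ((A : Matrix (Fin (n + 1)) (Fin (n + 1)) ℝ).mulVec x)
      ((A : Matrix (Fin (n + 1)) (Fin (n + 1)) ℝ).mulVec y) = lorentzB n x y}
  mul_mem' := by
    intro a b ha hb x y
    simp only [Units.val_mul, ← Matrix.mulVec_mulVec]
    rw [ha, hb]
  one_mem' := by
    intro x y
    simp [Matrix.one_mulVec]
  inv_mem' := by
    intro a ha x y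
    have h1 : ∀ v : Fin (n + 1) → ℝ,
        (a : Matrix (Fin (n + 1)) (Fin (n + 1)) ℝ).mulVec
          ((↑a⁻¹ : Matrix (Fin (n + 1)) (Fin (n + 1)) ℝ).mulVec v) = v := by
      intro v
      rw [Matrix.mulVec_mulVec, ← Units.val_mul, mul_inv_cancel]
      simp [Matrix.one_mulVec]
    conv_rhs => rw [← h1 x, ← h1 y]
    rw [ha]

open scoped commutatorElement

/-- The subgroup generated by a connected set containing `1` is connected. -/
theorem Subgroup.isPreconnected_closure {G : Type*} [Group G] [TopologicalSpace G]
    [IsTopologicalGroup G] {S : Set G} (hS : IsPreconnected S) (h1 : (1 : G) ∈ S) :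
    IsPreconnected (Subgroup.closure S : Set G) := by
  refine isPreconnected_of_forall 1 fun y hy => ?_
  induction hy using Subgroup.closure_induction with
  | mem x hx => exact ⟨S, Subgroup.subset_closure, h1, hx, hS⟩
  | one => exact ⟨{1}, by simp [one_mem], rfl, rfl, isPreconnected_singleton⟩
  | mul x y _ _ ihx ihy =>
    obtain ⟨s, hs, hs1, hxs, hsc⟩ := ihx
    obtain ⟨t, ht, ht1, hyt, htc⟩ := ihy
    refine ⟨(fun p : G × G => p.1 * p.2) '' s ×ˢ t, ?_, ⟨(1, 1), ⟨hs1, ht1⟩, one_mul 1⟩,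
      ⟨(x, y), ⟨hxs, hyt⟩, rfl⟩, (hsc.prod htc).image _ continuous_mul.continuousOn⟩
    rintro _ ⟨p, ⟨hp1, hp2⟩, rfl⟩
    exact mul_mem (hs hp1) (ht hp2)
  | inv x _ ihx =>
    obtain ⟨s, hs, hs1, hxs, hsc⟩ := ihx
    refine ⟨(fun p : G => p⁻¹) '' s, ?_, ⟨1, hs1, inv_one⟩, ⟨x, hxs, rfl⟩,
      hsc.image _ continuous_inv.continuousOn⟩
    rintro _ ⟨p, hp, rfl⟩
    exact inv_mem (hs hp)

/-- The commutator subgroup of a connected group is connected. -/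
theorem Subgroup.isPreconnected_commutator {G : Type*} [Group G] [TopologicalSpace G]
    [IsTopologicalGroup G] {K : Subgroup G} (hK : IsPreconnected (K : Set G)) :
    IsPreconnected ((⁅K, K⁆ : Subgroup G) : Set G) := by
  have h : {g : G | ∃ g₁ ∈ K, ∃ g₂ ∈ K, ⁅g₁, g₂⁆ = g} =
      (fun p : G × G => ⁅p.1, p.2⁆) '' ((K : Set G) ×ˢ (K : Set G)) := by
    ext g
    simp
  rw [Subgroup.commutator_def, h]
  refine isPreconnected_closure ((hK.prod hK).image _ ?_) ⟨(1, 1), by simp [one_mem], by simp⟩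
  simp only [commutatorElement_def]
  fun_prop

/-- A continuous function on a preconnected set with finitely many values is constant. -/
theorem IsPreconnected.eq_of_continuousOn_of_finite {X Y : Type*} [TopologicalSpace X]
    [TopologicalSpace Y] [T1Space Y] {s : Set X} (hs : IsPreconnected s) {f : X → Y}
    (hf : ContinuousOn f s) {F : Set Y} (hF : F.Finite) (hsF : Set.MapsTo f s F)
    {x y : X} (hx : x ∈ s) (hy : y ∈ s) : f x = f y := by
  by_contra hne
  exact (hs.image f hf).infinite_of_nontrivial
    ⟨f x, Set.mem_image_of_mem f hx, f y, Set.mem_image_of_mem f hy, hne⟩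
    (hF.subset hsF.image_subset)

/-- A commuting set of endomorphisms of a nonzero finite-dimensional vector space over an
algebraically closed field has a common eigenvector. -/
theorem Module.End.exists_common_eigenvector_of_commute {k V : Type*} [Field k] [IsAlgClosed k]
    [AddCommGroup V] [Module k V] [FiniteDimensional k V] [Nontrivial V]
    (S : Set (Module.End k V)) (hS : ∀ f ∈ S, ∀ g ∈ S, Commute f g) :
    ∃ v : V, v ≠ 0 ∧ ∀ f ∈ S, ∃ c : k, f v = c • v := by
  obtain ⟨W, ⟨hW0, hW⟩, hmin⟩ := (wellFounded_lt (α := Submodule k V)).has_min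
    {W | W ≠ ⊥ ∧ ∀ f ∈ S, ∀ x ∈ W, f x ∈ W} ⟨⊤, top_ne_bot, by simp⟩
  obtain ⟨v, hvW, hv⟩ := W.ne_bot_iff.1 hW0
  refine ⟨v, hv, fun f hf => ?_⟩
  have : Nontrivial W := Submodule.nontrivial_iff_ne_bot.2 hW0
  obtain ⟨c, hc⟩ := Module.End.exists_eigenvalue (f.restrict (hW f hf))
  obtain ⟨w, hw⟩ := hc.exists_hasEigenvector
  refine ⟨c, ?_⟩
  have hle : ¬ W ⊓ f.eigenspace c < W := by
    refine hmin _ ⟨?_, ?_⟩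
    · refine (Submodule.ne_bot_iff _).2 ⟨w, ⟨w.2, ?_⟩, by simpa using hw.2⟩
      rw [SetLike.mem_coe, Module.End.mem_eigenspace_iff]
      simpa using congrArg Subtype.val hw.apply_eq_smul
    · rintro g hg x ⟨hx, hxc⟩
      refine ⟨hW g hg x hx, ?_⟩
      rw [SetLike.mem_coe, Module.End.mem_eigenspace_iff] at hxc ⊢
      rw [← Module.End.mul_apply, (hS f hf g hg).eq, Module.End.mul_apply, hxc, map_smul]
  have := (inf_le_left.lt_or_eq.resolve_left hle).ge hvW
  exact Module.End.mem_eigenspace_iff.1 this.2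

section LieKolchin

variable {G : Type*} [Group G] [TopologicalSpace G] [IsTopologicalGroup G]
  {E : Type*} [NormedAddCommGroup E] [NormedSpace ℂ E] [FiniteDimensional ℂ E]

/-- If the commutator subgroup of a connected group has a common eigenvector, so has the group. -/
theorem exists_common_eigenvector_of_commutator (ρ : G →* Module.End ℂ E)
    (hρ : ∀ v, Continuous fun g => ρ g v) {K : Subgroup G} (hK : IsPreconnected (K : Set G))
    (h : ∃ v : E, v ≠ 0 ∧ ∀ g ∈ (⁅K, K⁆ : Subgroup G), ∃ c : ℂ, ρ g v = c • v) :
    ∃ v : E, v ≠ 0 ∧ ∀ g ∈ K, ∃ c : ℂ, ρ g v = c • v := by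
  obtain ⟨v, hv, hχ⟩ := h
  choose! χ hχ using hχ
  obtain ⟨φ, hφ⟩ := SeparatingDual.exists_eq_one (R := ℂ) hv
  have hDK : (⁅K, K⁆ : Subgroup G) ≤ K := Subgroup.commutator_le_self K
  have hconj : ∀ g ∈ K, ∀ h ∈ (⁅K, K⁆ : Subgroup G), g⁻¹ * h * g ∈ (⁅K, K⁆ : Subgroup G) := by
    intro g hg h hh
    have hc := mul_mem hh (Subgroup.commutator_mem_commutator (inv_mem (hDK hh)) (inv_mem hg))
    rw [commutatorElement_def] at hc
    convert hc using 1
    group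
  have hχφ : ∀ h ∈ (⁅K, K⁆ : Subgroup G), χ h = φ (ρ h v) := fun h hh => by
    rw [hχ h hh, map_smul, hφ, smul_eq_mul, mul_one]
  have hinj : ∀ (g : G) (x : E), x ≠ 0 → ρ g x ≠ 0 := fun g x hx h0 => hx <| by
    rw [← Module.End.one_apply (R := ℂ) x, ← map_one ρ, ← inv_mul_cancel g, map_mul,
      Module.End.mul_apply, h0, map_zero]
  have hswap : ∀ (g h : G) (x : E), ρ h (ρ g x) = ρ g (ρ (g⁻¹ * h * g) x) := fun g h x => by
    simp only [← Module.End.mul_apply, ← map_mul]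
    congr 2
    group
  have hχconj : ∀ g ∈ K, ∀ h ∈ (⁅K, K⁆ : Subgroup G), χ (g⁻¹ * h * g) = χ h := by
    intro g hg h hh
    have key := hK.eq_of_continuousOn_of_finite (f := fun g => φ (ρ (g⁻¹ * h * g) v))
      (φ.continuous.comp ((hρ v).comp (by fun_prop))).continuousOn
      (Module.End.finite_hasEigenvalue (ρ h)) (fun a ha => ?_) hg (one_mem K)
    · simpa [hχφ h hh, hχφ _ (hconj g hg h hh)] using key
    · rw [Set.mem_ofPred_eq]
      beta_reduce
      rw [← hχφ _ (hconj a ha h hh)]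
      refine Module.End.hasEigenvalue_of_hasEigenvector
        (x := ρ a v) ⟨Module.End.mem_eigenspace_iff.2 ?_, hinj a v hv⟩
      rw [hswap, hχ _ (hconj a ha h hh), map_smul]
  let W : Submodule ℂ E := ⨅ h ∈ (⁅K, K⁆ : Subgroup G), (ρ h).eigenspace (χ h)
  have hW : ∀ x, x ∈ W ↔ ∀ h ∈ (⁅K, K⁆ : Subgroup G), ρ h x = χ h • x := fun x => by
    simp [W, Submodule.mem_iInf]
  have hvW : v ∈ W := (hW v).2 hχ
  have hWinv : ∀ g ∈ K, ∀ x ∈ W, ρ g x ∈ W := by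
    intro g hg x hx
    rw [hW] at hx ⊢
    intro h hh
    rw [hswap, hx _ (hconj g hg h hh), map_smul, hχconj g hg h hh]
  have : Nontrivial W := ⟨⟨⟨v, hvW⟩, 0, fun h => hv (congrArg Subtype.val h)⟩⟩
  let r : K →* Module.End ℂ W :=
    { toFun := fun g => (ρ g).restrict (hWinv g g.2)
      map_one' := by ext; simp
      map_mul' := fun a b => by ext; simp }
  have hr : ∀ (g : K) (x : W), (r g x : E) = ρ g x := fun _ _ => rfl
  have hpow : ∀ h ∈ (⁅K, K⁆ : Subgroup G), χ h ^ Module.finrank ℂ W = 1 := by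
    intro h hh
    have hker : (⁅K, K⁆ : Subgroup G) ≤
        (((LinearMap.det (M := W) (A := ℂ)).comp r).toHomUnits.ker).map K.subtype := by
      rw [Subgroup.commutator_le]
      intro a ha b hb
      refine ⟨⁅(⟨a, ha⟩ : K), ⟨b, hb⟩⁆, ?_, rfl⟩
      rw [SetLike.mem_coe, MonoidHom.mem_ker, map_commutatorElement, commutatorElement_eq_one_iff_mul_comm,
        mul_comm]
    obtain ⟨k, hk, rfl⟩ := hker hh
    have hk1 : LinearMap.det (r k) = 1 := congrArg Units.val (MonoidHom.mem_ker.1 hk)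
    have hrk : r k = χ (K.subtype k) • LinearMap.id := by
      ext x
      exact (hW x).1 x.2 _ hh
    rw [hrk, LinearMap.det_smul, LinearMap.det_id, mul_one] at hk1
    exact hk1
  have hχ1 : ∀ h ∈ (⁅K, K⁆ : Subgroup G), χ h = 1 := by
    intro h hh
    have key := (Subgroup.isPreconnected_commutator hK).eq_of_continuousOn_of_finite
      (f := fun g => φ (ρ g v)) (φ.continuous.comp (hρ v)).continuousOn
      (F := {z : ℂ | z ^ Module.finrank ℂ W = 1}) ?_ (fun a ha => ?_) hh (one_mem _)
    · simpa [hχφ h hh, hφ] using key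
    · refine (Polynomial.nthRootsFinset (Module.finrank ℂ W) (1 : ℂ)).finite_toSet.subset ?_
      intro z hz
      exact (Polynomial.mem_nthRootsFinset Module.finrank_pos _).2 hz
    · rw [Set.mem_ofPred_eq]
      beta_reduce
      rw [← hχφ a ha]
      exact hpow a ha
  obtain ⟨w, hw, hwS⟩ := Module.End.exists_common_eigenvector_of_commute (Set.range r) (by
    rintro _ ⟨a, rfl⟩ _ ⟨b, rfl⟩
    ext x
    have hc : ⁅(a : G)⁻¹, (b : G)⁻¹⁆ ∈ (⁅K, K⁆ : Subgroup G) :=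
      Subgroup.commutator_mem_commutator (inv_mem a.2) (inv_mem b.2)
    have hx := (hW x).1 x.2 _ hc
    rw [hχ1 _ hc, one_smul] at hx
    simp only [Module.End.mul_apply, hr]
    conv_rhs => rw [← hx]
    simp only [← Module.End.mul_apply, ← map_mul, commutatorElement_def]
    congr 2
    group)
  refine ⟨w, by simpa using hw, fun g hg => ?_⟩
  obtain ⟨c, hc⟩ := hwS _ ⟨⟨g, hg⟩, rfl⟩
  exact ⟨c, congrArg Subtype.val hc⟩

/-- **Lie–Kolchin theorem** for connected solvable topological groups. -/
theorem exists_common_eigenvector_of_isSolvable [PreconnectedSpace G] [Group.IsSolvable G]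
    [Nontrivial E] (ρ : G →* Module.End ℂ E) (hρ : ∀ v, Continuous fun g => ρ g v) :
    ∃ v : E, v ≠ 0 ∧ ∀ g, ∃ c : ℂ, ρ g v = c • v := by
  have hconn : ∀ n, IsPreconnected (derivedSeries G n : Set G) := by
    intro n
    induction n with
    | zero => simpa using isPreconnected_univ
    | succ n ih => exact Subgroup.isPreconnected_commutator ih
  obtain ⟨N, hN⟩ := Group.IsSolvable.solvable (G := G)
  obtain ⟨v, hv⟩ := exists_ne (0 : E)
  have := Nat.decreasingInduction
    (motive := fun k _ => ∃ v : E, v ≠ 0 ∧ ∀ g ∈ derivedSeries G k, ∃ c : ℂ, ρ g v = c • v)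
    (fun k _ ih => exists_common_eigenvector_of_commutator ρ hρ (hconn k) ih)
    ⟨v, hv, fun g hg => ⟨1, by simp_all⟩⟩ (Nat.zero_le N)
  simpa using this

end LieKolchin

section Lorentz

variable {n : ℕ}

theorem lorentzB_comm (x y : Fin (n + 1) → ℝ) : lorentzB n x y = lorentzB n y x := by
  simp [lorentzB, mul_comm]

theorem lorentzB_add_left (x y z : Fin (n + 1) → ℝ) :
    lorentzB n (x + y) z = lorentzB n x z + lorentzB n y z := by
  simp only [lorentzB, Pi.add_apply, add_mul, Finset.sum_add_distrib]
  ring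

theorem lorentzB_smul_left (c : ℝ) (x y : Fin (n + 1) → ℝ) :
    lorentzB n (c • x) y = c * lorentzB n x y := by
  simp only [lorentzB, Pi.smul_apply, smul_eq_mul, mul_assoc, mul_add, Finset.mul_sum, mul_neg]

theorem lorentzB_sub_left (x y z : Fin (n + 1) → ℝ) :
    lorentzB n (x - y) z = lorentzB n x z - lorentzB n y z := by
  rw [sub_eq_add_neg, ← neg_one_smul ℝ y, lorentzB_add_left, lorentzB_smul_left]
  ring

theorem lorentzB_add_right (x y z : Fin (n + 1) → ℝ) :
    lorentzB n x (y + z) = lorentzB n x y + lorentzB n x z := by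
  simp only [lorentzB_comm x, lorentzB_add_left]

theorem lorentzB_smul_right (c : ℝ) (x y : Fin (n + 1) → ℝ) :
    lorentzB n x (c • y) = c * lorentzB n x y := by
  simp only [lorentzB_comm x, lorentzB_smul_left]

theorem lorentzB_sub_right (x y z : Fin (n + 1) → ℝ) :
    lorentzB n x (y - z) = lorentzB n x y - lorentzB n x z := by
  simp only [lorentzB_comm x, lorentzB_sub_left]

/-- The Lorentzian form is positive definite on the hyperplane `x₀ = 0`. -/
theorem eq_zero_of_lorentzB_self_nonpos {x : Fin (n + 1) → ℝ} (h0 : x 0 = 0)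
    (hx : lorentzB n x x ≤ 0) : x = 0 := by
  have hsum : ∑ i : Fin n, x i.succ * x i.succ = 0 :=
    le_antisymm (by simpa [lorentzB, h0] using hx)
      (Finset.sum_nonneg fun i _ => mul_self_nonneg _)
  rw [Finset.sum_eq_zero_iff_of_nonneg fun i _ => mul_self_nonneg _] at hsum
  ext i
  refine Fin.cases h0 (fun j => ?_) i
  exact mul_self_eq_zero.1 (hsum j (Finset.mem_univ j))

/-- Two orthogonal vectors of equal nonpositive norm are linearly dependent. -/
theorem exists_eq_smul_of_lorentzB_nonpos {u v : Fin (n + 1) → ℝ} (hu : u ≠ 0)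
    (huv : lorentzB n u v = 0) (heq : lorentzB n u u = lorentzB n v v)
    (hle : lorentzB n u u ≤ 0) : ∃ t : ℝ, v = t • u := by
  have hu0 : u 0 ≠ 0 := fun h => hu (eq_zero_of_lorentzB_self_nonpos h hle)
  have hz : v 0 • u - u 0 • v = 0 := by
    refine eq_zero_of_lorentzB_self_nonpos (by simp [mul_comm]) ?_
    simp only [lorentzB_sub_left, lorentzB_sub_right, lorentzB_smul_left, lorentzB_smul_right,
      lorentzB_comm v u, huv, ← heq]
    nlinarith [mul_nonneg (sq_nonneg (v 0)) (neg_nonneg.2 hle),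
      mul_nonneg (sq_nonneg (u 0)) (neg_nonneg.2 hle)]
  refine ⟨(u 0)⁻¹ * v 0, ?_⟩
  rw [mul_smul, sub_eq_zero.1 hz, smul_smul, inv_mul_cancel₀ hu0, one_smul]

/-- The complexification of a real subspace of `ℝ^m`, inside `ℂ^m`. -/
def complexifySubmodule {ι : Type*} (W : Submodule ℝ (ι → ℝ)) : Submodule ℂ (ι → ℂ) where
  carrier := {z | (fun i => (z i).re) ∈ W ∧ (fun i => (z i).im) ∈ W}
  zero_mem' := ⟨W.zero_mem, W.zero_mem⟩
  add_mem' := fun ha hb => ⟨W.add_mem ha.1 hb.1, W.add_mem ha.2 hb.2⟩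
  smul_mem' := fun c z hz => by
    refine ⟨?_, ?_⟩
    · convert W.sub_mem (W.smul_mem c.re hz.1) (W.smul_mem c.im hz.2) using 1
      ext i
      simp
    · convert W.add_mem (W.smul_mem c.re hz.2) (W.smul_mem c.im hz.1) using 1
      ext i
      simp

theorem mem_complexifySubmodule {ι : Type*} {W : Submodule ℝ (ι → ℝ)} {z : ι → ℂ} :
    z ∈ complexifySubmodule W ↔ (fun i => (z i).re) ∈ W ∧ (fun i => (z i).im) ∈ W :=
  Iff.rfl

/-- A real direction preserved up to scalars by a connected group is preserved. -/
theorem exists_pos_of_forall_exists_smul {m : Type*} [Fintype m] [DecidableEq m]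
    {H : Subgroup (GL m ℝ)} (hconn : IsPreconnected (H : Set (GL m ℝ))) {v : m → ℝ} (hv : v ≠ 0)
    (h : ∀ g ∈ H, ∃ c : ℝ, (g : Matrix m m ℝ).mulVec v = c • v) :
    ∀ g ∈ H, ∃ c : ℝ, 0 < c ∧ (g : Matrix m m ℝ).mulVec v = c • v := by
  obtain ⟨i, hi⟩ := Function.ne_iff.1 hv
  have hi : v i ≠ 0 := hi
  let f : GL m ℝ → ℝ := fun g => ((g : Matrix m m ℝ).mulVec v) i / v i
  have hf : Continuous f := by
    have : Continuous fun g : GL m ℝ => (g : Matrix m m ℝ).mulVec v :=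
      Units.continuous_val.matrix_mulVec continuous_const
    exact ((continuous_apply i).comp this).div_const _
  have hfg : ∀ g ∈ H, (g : Matrix m m ℝ).mulVec v = f g • v := fun g hg => by
    obtain ⟨c, hc⟩ := h g hg
    simp [f, hc, hi]
  have hf0 : ∀ g ∈ H, f g ≠ 0 := fun g hg h0 => hv <| by
    have := hfg g hg
    rw [h0, zero_smul] at this
    rw [← Matrix.one_mulVec v, ← Units.val_one, ← inv_mul_cancel g, Units.val_mul,
      ← Matrix.mulVec_mulVec, this, Matrix.mulVec_zero]
  intro g hg
  refine ⟨f g, ?_, hfg g hg⟩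
  by_contra hneg
  have h1 : f 1 = 1 := by simp [f, hi]
  obtain ⟨k, hk, hk0⟩ := hconn.intermediate_value hg (one_mem H) hf.continuousOn
    (show (0 : ℝ) ∈ Set.Icc (f g) (f 1) from ⟨not_lt.1 hneg, by simp [h1]⟩)
  exact hf0 k hk hk0

/-- A connected solvable group of real matrices preserving a nonzero subspace `W` stabilizes the
span of two vectors of `W`, on which it acts by complex multiplication. -/
theorem exists_complex_eigenvector_of_isSolvable {m : Type*} [Fintype m] [DecidableEq m]
    {H : Subgroup (GL m ℝ)} (hconn : IsPreconnected (H : Set (GL m ℝ))) [Group.IsSolvable H]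
    {W : Submodule ℝ (m → ℝ)} (hW0 : W ≠ ⊥)
    (hW : ∀ g ∈ H, ∀ x ∈ W, (g : Matrix m m ℝ).mulVec x ∈ W) :
    ∃ u ∈ W, ∃ v ∈ W, (u ≠ 0 ∨ v ≠ 0) ∧ ∀ g ∈ H, ∃ a b : ℝ,
      (g : Matrix m m ℝ).mulVec u = a • u - b • v ∧
      (g : Matrix m m ℝ).mulVec v = b • u + a • v := by
  have : PreconnectedSpace H := Subtype.preconnectedSpace hconn
  let ρ₀ : H →* Module.End ℂ (m → ℂ) :=
    ((Matrix.toLinAlgEquiv' : Matrix m m ℂ ≃ₐ[ℂ] _) : Matrix m m ℂ →* _).comp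
      (((Complex.ofRealHom.mapMatrix : Matrix m m ℝ →+* Matrix m m ℂ) : Matrix m m ℝ →* _).comp
        ((Units.coeHom _).comp H.subtype))
  have hρ₀ : ∀ (g : H) (z : m → ℂ),
      ρ₀ g z = ((g : GL m ℝ) : Matrix m m ℝ).map Complex.ofRealHom *ᵥ z := fun _ _ => rfl
  have hre : ∀ (g : H) (z : m → ℂ), (fun i => (ρ₀ g z i).re) =
      ((g : GL m ℝ) : Matrix m m ℝ).mulVec fun i => (z i).re := fun g z => by
    ext i
    simp [hρ₀, Matrix.mulVec, dotProduct]
  have him : ∀ (g : H) (z : m → ℂ), (fun i => (ρ₀ g z i).im) =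
      ((g : GL m ℝ) : Matrix m m ℝ).mulVec fun i => (z i).im := fun g z => by
    ext i
    simp [hρ₀, Matrix.mulVec, dotProduct]
  have hinv : ∀ (g : H), ∀ z ∈ complexifySubmodule W, ρ₀ g z ∈ complexifySubmodule W := by
    intro g z hz
    rw [mem_complexifySubmodule] at hz ⊢
    rw [hre, him]
    exact ⟨hW g g.2 _ hz.1, hW g g.2 _ hz.2⟩
  let ρ : H →* Module.End ℂ (complexifySubmodule W) :=
    { toFun := fun g => (ρ₀ g).restrict (hinv g)
      map_one' := by ext; simp
      map_mul' := fun a b => by ext; simp }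
  have hρ : ∀ z, Continuous fun g => ρ g z := fun z => by
    refine Continuous.subtype_mk (f := fun g => ρ₀ g z) ?_ _
    simp only [hρ₀]
    exact ((Units.continuous_val.comp continuous_subtype_val).matrix_map
      Complex.continuous_ofReal).matrix_mulVec continuous_const
  obtain ⟨x, hxW, hx⟩ := W.ne_bot_iff.1 hW0
  have : Nontrivial (complexifySubmodule W) := by
    refine ⟨⟨⟨fun i => (x i : ℂ), mem_complexifySubmodule.2 ⟨by simpa using hxW, ?_⟩⟩, 0,
      fun h => hx ?_⟩⟩
    · exact W.zero_mem
    · ext i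
      simpa using congrFun (congrArg Subtype.val h) i
  obtain ⟨⟨w, hwW⟩, hw, hχ⟩ := exists_common_eigenvector_of_isSolvable ρ hρ
  refine ⟨_, hwW.1, _, hwW.2, ?_, fun g hg => ?_⟩
  · by_contra! h
    refine hw (Subtype.ext (funext fun i => Complex.ext ?_ ?_))
    · exact congrFun h.1 i
    · exact congrFun h.2 i
  · obtain ⟨c, hc⟩ := hχ ⟨g, hg⟩
    have hc : ρ₀ ⟨g, hg⟩ w = c • w := congrArg Subtype.val hc
    refine ⟨c.re, c.im, ?_, ?_⟩
    · rw [← hre ⟨g, hg⟩, hc]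
      ext i
      simp
    · rw [← him ⟨g, hg⟩, hc]
      ext i
      simp [add_comm]

/-- If `H` acts on the span of `u` and `v` by complex multiplication and this span is not
positive definite, then some line in it is invariant. -/
theorem exists_invariant_line_of_not_pos {H : Subgroup (GL (Fin (n + 1)) ℝ)}
    (hHO : H ≤ LorentzO n) {u v : Fin (n + 1) → ℝ} (huv : u ≠ 0 ∨ v ≠ 0)
    (hact : ∀ g ∈ H, ∃ a b : ℝ,
      (g : Matrix (Fin (n + 1)) (Fin (n + 1)) ℝ).mulVec u = a • u - b • v ∧
      (g : Matrix (Fin (n + 1)) (Fin (n + 1)) ℝ).mulVec v = b • u + a • v)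
    (hpos : ¬ (lorentzB n u v = 0 ∧ lorentzB n u u = lorentzB n v v ∧ 0 < lorentzB n u u)) :
    ∃ w : Fin (n + 1) → ℝ, w ≠ 0 ∧ ∀ g ∈ H, ∃ c : ℝ,
      (g : Matrix (Fin (n + 1)) (Fin (n + 1)) ℝ).mulVec w = c • w := by
  by_cases hiso : lorentzB n u v = 0 ∧ lorentzB n u u = lorentzB n v v
  · have hle : lorentzB n u u ≤ 0 := not_lt.1 fun h => hpos ⟨hiso.1, hiso.2, h⟩
    by_cases hu : u = 0
    · refine ⟨v, huv.resolve_left (not_not.2 hu), fun g hg => ?_⟩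
      obtain ⟨a, b, -, hgv⟩ := hact g hg
      exact ⟨a, by simpa [hu] using hgv⟩
    · obtain ⟨t, rfl⟩ := exists_eq_smul_of_lorentzB_nonpos hu hiso.1 hiso.2 hle
      refine ⟨u, hu, fun g hg => ?_⟩
      obtain ⟨a, b, hgu, -⟩ := hact g hg
      exact ⟨a - b * t, by rw [hgu, sub_smul, smul_smul]⟩
  · have hb : ∀ g ∈ H, ∃ a : ℝ,
        (g : Matrix (Fin (n + 1)) (Fin (n + 1)) ℝ).mulVec u = a • u ∧
        (g : Matrix (Fin (n + 1)) (Fin (n + 1)) ℝ).mulVec v = a • v := by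
      intro g hg
      obtain ⟨a, b, hgu, hgv⟩ := hact g hg
      have h1 := hHO hg u u
      have h2 := hHO hg v v
      have h3 := hHO hg u v
      simp only [hgu, hgv, lorentzB_sub_left, lorentzB_sub_right, lorentzB_add_left,
        lorentzB_add_right, lorentzB_smul_left, lorentzB_smul_right, lorentzB_comm v u]
        at h1 h2 h3
      let c : ℂ := ⟨a, b⟩
      let z : ℂ := ⟨lorentzB n u u - lorentzB n v v, 2 * lorentzB n u v⟩
      have hz : z ≠ 0 := fun h => hiso <| by
        have hzre := congrArg Complex.re h
        have hzim := congrArg Complex.im h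
        simp only [z, Complex.zero_re, Complex.zero_im] at hzre hzim
        exact ⟨by linarith, by linarith⟩
      have hcz : c ^ 2 * z = 1 * z := by
        apply Complex.ext
        · simp [c, z, pow_two]
          linear_combination h1 - h2
        · simp [c, z, pow_two]
          linear_combination 2 * h3
      have hb0 : b = 0 := by
        rcases eq_or_eq_neg_of_sq_eq_sq c 1 (by rw [one_pow]; exact mul_right_cancel₀ hz hcz) with h | h <;>
        simpa [c] using congrArg Complex.im h
      subst hb0
      exact ⟨a, by simpa using hgu, by simpa using hgv⟩
    rcases huv with hu | hv
    · exact ⟨u, hu, fun g hg => (hb g hg).imp fun _ h => h.1⟩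
    · exact ⟨v, hv, fun g hg => (hb g hg).imp fun _ h => h.2⟩

end Lorentz

/-- Any connected solvable subgroup of `O(1,n)` (`n ≥ 1`) preserves a
direction in `ℝ^{n+1}`: there is `v ≠ 0` with `g · v ∈ ℝ_{>0} · v` for all `g ∈ H`. -/
theorem connected_solvable_subgroup_of_lorentz_preserves_direction
    (n : ℕ) (hn : 1 ≤ n) (H : Subgroup (GL (Fin (n + 1)) ℝ))
    (hHO : H ≤ LorentzO n)
    (hconn : IsConnected (H : Set (GL (Fin (n + 1)) ℝ)))
    (hsolv : IsSolvable ↥H) :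
    ∃ v : Fin (n + 1) → ℝ, v ≠ 0 ∧ ∀ g ∈ H, ∃ c : ℝ, 0 < c ∧
      (g : Matrix (Fin (n + 1)) (Fin (n + 1)) ℝ).mulVec v = c • v := by
  have hsolv' : Group.IsSolvable H := hsolv
  obtain ⟨W, ⟨⟨t, htW, ht⟩, hW⟩, hmin⟩ :=
    (wellFounded_lt (α := Submodule ℝ (Fin (n + 1) → ℝ))).has_min
    {W | (∃ t ∈ W, lorentzB n t t < 0) ∧
      ∀ g ∈ H, ∀ x ∈ W, (g : Matrix (Fin (n + 1)) (Fin (n + 1)) ℝ).mulVec x ∈ W}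
    ⟨⊤, ⟨Pi.single 0 1, trivial, by simp [lorentzB]⟩, by simp⟩
  have hW0 : W ≠ ⊥ := W.ne_bot_iff.2 ⟨t, htW, fun h => by simp [h, lorentzB] at ht⟩
  obtain ⟨u, hu, v, hv, huv, hact⟩ :=
    exists_complex_eigenvector_of_isSolvable hconn.isPreconnected hW0 hW
  suffices hpos : ¬ (lorentzB n u v = 0 ∧ lorentzB n u u = lorentzB n v v ∧
      0 < lorentzB n u u) by
    obtain ⟨w, hw, hwH⟩ := exists_invariant_line_of_not_pos hHO huv hact hpos
    exact ⟨w, hw, exists_pos_of_forall_exists_smul hconn.isPreconnected hw hwH⟩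
  rintro ⟨huv0, heq, hpos⟩
  let P : Submodule ℝ (Fin (n + 1) → ℝ) :=
    { carrier := {x | lorentzB n x u = 0 ∧ lorentzB n x v = 0}
      zero_mem' := by simp [lorentzB]
      add_mem' := fun ha hb => by
        simp only [Set.mem_ofPred_eq] at ha hb ⊢
        simp [lorentzB_add_left, ha, hb]
      smul_mem' := fun c x hx => by
        simp only [Set.mem_ofPred_eq] at hx ⊢
        simp [lorentzB_smul_left, hx] }
  refine hmin (W ⊓ P) ⟨⟨t - (lorentzB n t u / lorentzB n u u) • u -
    (lorentzB n t v / lorentzB n u u) • v, ⟨?_, ?_, ?_⟩, ?_⟩, ?_⟩ ?_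
  · exact W.sub_mem (W.sub_mem htW (W.smul_mem _ hu)) (W.smul_mem _ hv)
  · simp only [lorentzB_sub_left, lorentzB_smul_left, lorentzB_comm v u, huv0]
    field_simp
    ring
  · simp only [lorentzB_sub_left, lorentzB_smul_left, ← heq, huv0]
    field_simp
    ring
  · have hq : lorentzB n (t - (lorentzB n t u / lorentzB n u u) • u -
        (lorentzB n t v / lorentzB n u u) • v) (t - (lorentzB n t u / lorentzB n u u) • u -
        (lorentzB n t v / lorentzB n u u) • v) =
        lorentzB n t t - (lorentzB n t u ^ 2 + lorentzB n t v ^ 2) / lorentzB n u u := by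
      simp only [lorentzB_sub_left, lorentzB_smul_left, lorentzB_sub_right, lorentzB_smul_right,
        lorentzB_comm v u, lorentzB_comm u t, lorentzB_comm v t, ← heq, huv0]
      field_simp
      ring
    rw [hq]
    have : 0 ≤ (lorentzB n t u ^ 2 + lorentzB n t v ^ 2) / lorentzB n u u := by positivity
    linarith
  · rintro g hg x ⟨hxW, hxu, hxv⟩
    obtain ⟨a, b, hgu, hgv⟩ := hact g⁻¹ (inv_mem hg)
    have hadj : ∀ y, lorentzB n ((g : Matrix (Fin (n + 1)) (Fin (n + 1)) ℝ).mulVec x) y =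
        lorentzB n x ((↑g⁻¹ : Matrix (Fin (n + 1)) (Fin (n + 1)) ℝ).mulVec y) := fun y => by
      rw [← hHO (inv_mem hg), Matrix.mulVec_mulVec, ← Units.val_mul, inv_mul_cancel,
        Units.val_one, Matrix.one_mulVec]
    refine ⟨hW g hg x hxW, ?_, ?_⟩
    · rw [hadj, hgu]
      simp [lorentzB_sub_right, lorentzB_smul_right, hxu, hxv]
    · rw [hadj, hgv]
      simp [lorentzB_add_right, lorentzB_smul_right, hxu, hxv]
  · exact inf_le_left.lt_of_ne fun h => hpos.ne' (h.ge hu).2.1
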